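/- Fix reals m < M, k ∈ ℝ and k′ > 0, let H : [m,M] → ℝ be continuous, and let u, v : [m,M] → ℝ be bounded. Define, for any bounded w : [m,M] → ℝ, (M w)(r) = sup_{0 ≤ ζ ≤ M−r} ( w(r+ζ) − H(r+ζ) + H(r) − k ). If r ∈ [m,M] satisfies u(r) ≤ (M u)(r) and v(r) ≥ (M v)(r) + k′, then u(r) − v(r) ≤ sup_{z ∈ [m,M]} ( u(z) − v(z) ) − k′. -/

import Mathlib

open Set

/-- Intervention operator
`(M w)(r) = sup_{0 ≤ ζ ≤ M - r} ( w(r+ζ) - H(r+ζ) + H(r) - k )`. -/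
noncomputable def Mop (M k : ℝ) (H w : ℝ → ℝ) (r : ℝ) : ℝ :=
  sSup ((fun ζ : ℝ => w (r + ζ) - H (r + ζ) + H r - k) '' Icc 0 (M - r))

/-- Key step in the intervention branch of the proof of the comparison
principle (Proposition 4.1): if at `r` the subsolution equals its intervened
value while the supersolution dominates its intervened value by `k'`, then
the gap `u - v` at `r` is at least `k'` below the maximal gap. -/
theorem intervention_branch_gap
    (m M k k' : ℝ) (hmM : m < M) (hk' : 0 < k')
    (H : ℝ → ℝ) (hH : ContinuousOn H (Icc m M))
    (u v : ℝ → ℝ)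
    (hu_bdd : ∃ C : ℝ, ∀ z ∈ Icc m M, |u z| ≤ C)
    (hv_bdd : ∃ C : ℝ, ∀ z ∈ Icc m M, |v z| ≤ C)
    (r : ℝ) (hr : r ∈ Icc m M)
    (hu : u r ≤ Mop M k H u r)
    (hv : Mop M k H v r + k' ≤ v r) :
    u r - v r ≤ sSup ((fun z : ℝ => u z - v z) '' Icc m M) - k' := by
  obtain ⟨A, hA⟩ := hu_bdd
  obtain ⟨B, hB⟩ := hv_bdd
  obtain ⟨D, hD⟩ := isCompact_Icc.exists_bound_of_continuousOn hH
  have hgap : BddAbove ((fun z : ℝ => u z - v z) '' Icc m M) := by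
    refine ⟨A + B, ?_⟩
    rintro _ ⟨z, hz, rfl⟩
    have h₁ := abs_le.mp (hA z hz)
    have h₂ := abs_le.mp (hB z hz)
    dsimp only
    linarith
  have hshift : ∀ ζ ∈ Icc 0 (M - r), r + ζ ∈ Icc m M := fun ζ hζ =>
    ⟨by linarith [hr.1, hζ.1], by linarith [hζ.2]⟩
  have hvM : BddAbove
      ((fun ζ : ℝ => v (r + ζ) - H (r + ζ) + H r - k) '' Icc 0 (M - r)) := by
    refine ⟨B + D + H r - k, ?_⟩
    rintro _ ⟨ζ, hζ, rfl⟩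
    have h₁ := abs_le.mp (hB _ (hshift ζ hζ))
    have h₂ := abs_le.mp (hD _ (hshift ζ hζ))
    dsimp only
    linarith
  have hMop : Mop M k H u r ≤
      Mop M k H v r + sSup ((fun z : ℝ => u z - v z) '' Icc m M) := by
    refine csSup_le ((nonempty_Icc.mpr (sub_nonneg.mpr hr.2)).image _) ?_
    rintro _ ⟨ζ, hζ, rfl⟩
    have h₁ : v (r + ζ) - H (r + ζ) + H r - k ≤ Mop M k H v r :=
      le_csSup hvM (mem_image_of_mem _ hζ)
    have h₂ := le_csSup hgap (mem_image_of_mem _ (hshift ζ hζ))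
    dsimp only at h₂ ⊢
    linarith
  linarith
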